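/- arXiv:2603.21805 — 2 statements merged into one kernel-verified Lean document; each statement's English description precedes it below -/
import Mathlib

section
/- Fix d ≥ 1. There exist δ ∈ (0, 1/8] and C > 0 such that for every ξ ∈ ℝ^d with ‖ξ‖ < δ, every t ≥ 1 and every v = (v₀, v₁) ∈ ℂ²: |(exp(tM(ξ)) v)₁ + ‖ξ‖² e^{−t‖ξ‖²}(v₀ + v₁)| ≤ C t^{−2} |v|_ξ, where |w|²_ξ := (‖ξ‖²+1)|w₀|² + |w₁|². -/
/-- The symbol `M(ξ)` of the damped wave equation `∂²ₜu + ∂ₜu = Δu` on the Fourier side: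
the `2×2` complex matrix with rows `(0, 1)` and `(−‖ξ‖², −1)`. -/
noncomputable def dwSymbol (d : ℕ) (ξ : EuclideanSpace ℝ (Fin d)) :
    Matrix (Fin 2) (Fin 2) ℂ :=
  !![0, 1; -(‖ξ‖ : ℂ) ^ 2, -1]

/-- The propagator `exp(t M(ξ))` (matrix exponential). -/
noncomputable def dwProp (d : ℕ) (t : ℝ) (ξ : EuclideanSpace ℝ (Fin d)) :
    Matrix (Fin 2) (Fin 2) ℂ :=
  NormedSpace.exp ((t : ℂ) • dwSymbol d ξ)

/-- The `ξ`-weighted (energy) norm `|w|_ξ = ((‖ξ‖²+1)|w₀|² + |w₁|²)^{1/2}` on `ℂ²`. -/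
noncomputable def xiNorm (d : ℕ) (ξ : EuclideanSpace ℝ (Fin d)) (w : Fin 2 → ℂ) : ℝ :=
  Real.sqrt ((‖ξ‖ ^ 2 + 1) * ‖w 0‖ ^ 2 + ‖w 1‖ ^ 2)

/-- Closed form of the second component, with `-a`, `-(1-a)` the eigenvalues. -/
lemma dwProp_second (d : ℕ) (t : ℝ) (ξ : EuclideanSpace ℝ (Fin d)) (v : Fin 2 → ℂ) (a : ℝ)
    (ha : a ≤ 1 / 4) (hr : ‖ξ‖ ^ 2 = a * (1 - a)) :
    (dwProp d t ξ).mulVec v 1 =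
      (((-(a * (1 - a)) * Real.exp (-(a * t)) + a * (1 - a) * Real.exp (-((1 - a) * t)))
        / (1 - 2 * a) : ℝ) : ℂ) * v 0
      + (((-a * Real.exp (-(a * t)) + (1 - a) * Real.exp (-((1 - a) * t)))
        / (1 - 2 * a) : ℝ) : ℂ) * v 1 := by
  have hs : (1 - 2 * a : ℝ) ≠ 0 := by linarith
  have hsc : (1 - 2 * (a : ℂ)) ≠ 0 := by exact_mod_cast hs
  have hrc : ((‖ξ‖ : ℂ)) ^ 2 = a * (1 - a) := by exact_mod_cast hr
  obtain ⟨k, hk⟩ : ∃ k : ℂ, k * (1 - 2 * (a : ℂ)) = 1 := ⟨_, inv_mul_cancel₀ hsc⟩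
  have hkinv : (1 - 2 * (a : ℂ))⁻¹ = k := inv_eq_of_mul_eq_one_left hk
  let U : Matrix (Fin 2) (Fin 2) ℂ := !![1, 1; -(a : ℂ), -(1 - a)]
  let Q : Matrix (Fin 2) (Fin 2) ℂ := !![(1 - a) * k, k; -(a : ℂ) * k, -k]
  have hUQ : U * Q = 1 := by
    simp only [U, Q, Matrix.mul_fin_two, Matrix.one_fin_two]
    congr! 1
    ext i j
    fin_cases i <;> fin_cases j <;> simp <;> first | linear_combination hk | ring
  have hinv : U⁻¹ = Q := Matrix.inv_eq_right_inv hUQ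
  have hunit : IsUnit U := IsUnit.of_mul_eq_one Q hUQ
  have hD : ∀ f : Fin 2 → ℂ, Matrix.diagonal f = !![f 0, 0; 0, f 1] := by
    intro f
    ext i j
    fin_cases i <;> fin_cases j <;> simp
  have hM : (t : ℂ) • dwSymbol d ξ
      = U * Matrix.diagonal ![-((a : ℂ) * t), -((1 - a) * t)] * U⁻¹ := by
    rw [hinv, dwSymbol, hrc, hD]
    simp only [U, Q, Matrix.mul_fin_two]
    ext i j
    fin_cases i <;> fin_cases j <;> simp
    · ring
    · linear_combination (-(t : ℂ)) * hk
    · linear_combination ((t : ℂ) * a * (1 - a)) * hk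
    · linear_combination (t : ℂ) * hk
  have hexp : ∀ (f : Fin 2 → ℂ) (i : Fin 2), NormedSpace.exp f i = Complex.exp (f i) := by
    intro f i
    rw [Pi.coe_exp, Complex.exp_eq_exp_ℂ]
  rw [dwProp, hM, Matrix.exp_conj _ _ hunit, Matrix.exp_diagonal, hinv, hD, hexp, hexp]
  simp only [U, Q, Matrix.mul_fin_two]
  simp [Matrix.mulVec, dotProduct, Fin.sum_univ_two, div_eq_mul_inv, hkinv]
  ring

lemma sq_exp_bound (x : ℝ) (hx : 0 ≤ x) : x ^ 2 * Real.exp (-x) ≤ 2 := by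
  have h := Real.pow_div_factorial_le_exp x hx 2
  norm_num [Nat.factorial] at h
  rw [Real.exp_neg, ← div_eq_mul_inv, div_le_iff₀ (Real.exp_pos x)]
  linarith

lemma cube_exp_bound (x : ℝ) (hx : 0 ≤ x) : x ^ 3 * Real.exp (-x) ≤ 6 := by
  have h := Real.pow_div_factorial_le_exp x hx 3
  norm_num [Nat.factorial] at h
  rw [Real.exp_neg, ← div_eq_mul_inv, div_le_iff₀ (Real.exp_pos x)]
  linarith

lemma coeff_bounds (a r t : ℝ) (ha0 : 0 ≤ a) (ha : a ≤ 1 / 4) (hr : r = a * (1 - a))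
    (ht : 1 ≤ t) :
    |(-(a * (1 - a)) * Real.exp (-(a * t)) + a * (1 - a) * Real.exp (-((1 - a) * t)))
        / (1 - 2 * a) + r * Real.exp (-(t * r))| * t ^ 2 ≤ 100 ∧
    |(-a * Real.exp (-(a * t)) + (1 - a) * Real.exp (-((1 - a) * t)))
        / (1 - 2 * a) + r * Real.exp (-(t * r))| * t ^ 2 ≤ 100 := by
  have hr0 : 0 ≤ r := by rw [hr]; nlinarith
  have hr1 : r ≤ 1 := by nlinarith
  have har : a ≤ 2 * r := by nlinarith
  have hra : a - r = a ^ 2 := by rw [hr]; ring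
  have ha2 : a ^ 2 ≤ 4 * r ^ 2 := by nlinarith
  have hs : 1 / 2 ≤ 1 - 2 * a := by linarith
  have ht0 : 0 < t := by linarith
  have hB0 := Real.exp_pos (-((1 - a) * t))
  have hA0 := Real.exp_pos (-(a * t))
  have hE0 := Real.exp_pos (-(t * r))
  have hAE : Real.exp (-(a * t)) ≤ Real.exp (-(t * r)) := by
    apply Real.exp_le_exp.2; nlinarith
  have hEA : Real.exp (-(t * r)) - Real.exp (-(a * t))
      ≤ 4 * r ^ 2 * t * Real.exp (-(t * r)) := by
    have h1 : Real.exp (-(a * t)) = Real.exp (-(t * r)) * Real.exp (-(a ^ 2 * t)) := by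
      rw [← Real.exp_add]; congr 1; rw [← hra]; ring
    have h2 := Real.add_one_le_exp (-(a ^ 2 * t))
    have h3 : a ^ 2 * t ≤ 4 * r ^ 2 * t := by gcongr
    rw [h1]
    nlinarith
  have hE2 : t ^ 2 * (r ^ 2 * Real.exp (-(t * r))) ≤ 2 := by
    have := sq_exp_bound (t * r) (by positivity)
    linarith [mul_pow t r 2, show (t * r) ^ 2 * Real.exp (-(t * r))
      = t ^ 2 * (r ^ 2 * Real.exp (-(t * r))) by ring]
  have hE3 : t ^ 2 * (r ^ 3 * t * Real.exp (-(t * r))) ≤ 6 := by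
    have := cube_exp_bound (t * r) (by positivity)
    linarith [show (t * r) ^ 3 * Real.exp (-(t * r))
      = t ^ 2 * (r ^ 3 * t * Real.exp (-(t * r))) by ring]
  have hB : t ^ 2 * Real.exp (-((1 - a) * t)) ≤ 8 := by
    have := sq_exp_bound ((1 - a) * t) (by nlinarith)
    have h1 : 1 / 4 ≤ (1 - a) ^ 2 := by nlinarith
    have h2 : 1 / 4 * (t ^ 2 * Real.exp (-((1 - a) * t)))
      ≤ (1 - a) ^ 2 * (t ^ 2 * Real.exp (-((1 - a) * t))) := by gcongr
    nlinarith
  set A := Real.exp (-(a * t))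
  set B := Real.exp (-((1 - a) * t))
  set E := Real.exp (-(t * r))
  set s := 1 - 2 * a with hsdef
  have hs0 : 0 < s := by linarith
  have hsi : 1 / s ≤ 2 := by rw [div_le_iff₀ hs0]; linarith
  have hsi0 : 0 ≤ 1 / s := by positivity
  rw [← hr]
  have e1 : (-r * A + r * B) / s + r * E
      = r * (E - A) - (2 * a * r * A) * (1 / s) + (r * B) * (1 / s) := by
    field_simp; rw [hsdef]; ring
  have e2 : (-a * A + (1 - a) * B) / s + r * E
      = r * (E - A) - (2 * a * r * A) * (1 / s) - (a ^ 2 * A) * (1 / s)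
        + ((1 - a) * B) * (1 / s) := by
    rw [← hra]; field_simp; rw [hsdef]; ring
  have p1 : 0 ≤ t ^ 2 * (r * (E - A)) := by
    have : 0 ≤ E - A := by linarith
    positivity
  have p1' : t ^ 2 * (r * (E - A)) ≤ 24 := by
    calc t ^ 2 * (r * (E - A)) ≤ t ^ 2 * (r * (4 * r ^ 2 * t * E)) := by gcongr
      _ = 4 * (t ^ 2 * (r ^ 3 * t * E)) := by ring
      _ ≤ 24 := by linarith
  have p2 : 0 ≤ t ^ 2 * ((2 * a * r * A) * (1 / s)) := by positivity
  have p2' : t ^ 2 * ((2 * a * r * A) * (1 / s)) ≤ 16 := by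
    calc t ^ 2 * ((2 * a * r * A) * (1 / s)) ≤ t ^ 2 * ((2 * (2 * r) * r * E) * 2) := by gcongr
      _ = 8 * (t ^ 2 * (r ^ 2 * E)) := by ring
      _ ≤ 16 := by linarith
  have p3 : 0 ≤ t ^ 2 * ((a ^ 2 * A) * (1 / s)) := by positivity
  have p3' : t ^ 2 * ((a ^ 2 * A) * (1 / s)) ≤ 16 := by
    calc t ^ 2 * ((a ^ 2 * A) * (1 / s)) ≤ t ^ 2 * ((4 * r ^ 2 * E) * 2) := by gcongr
      _ = 8 * (t ^ 2 * (r ^ 2 * E)) := by ring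
      _ ≤ 16 := by linarith
  have pB : ∀ c : ℝ, 0 ≤ c → c ≤ 1 →
      0 ≤ t ^ 2 * ((c * B) * (1 / s)) ∧ t ^ 2 * ((c * B) * (1 / s)) ≤ 16 := by
    intro c hc hc1
    refine ⟨by positivity, ?_⟩
    calc t ^ 2 * ((c * B) * (1 / s)) ≤ t ^ 2 * ((1 * B) * 2) := by gcongr
      _ = 2 * (t ^ 2 * B) := by ring
      _ ≤ 16 := by linarith
  have q1 := pB r hr0 hr1
  have q2 := pB (1 - a) (by linarith) (by linarith)
  have habs : ∀ x : ℝ, |x| * t ^ 2 = |t ^ 2 * x| := by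
    intro x; rw [abs_mul, abs_of_nonneg (by positivity : 0 ≤ t ^ 2)]; ring
  rw [habs, habs, e1, e2, abs_le, abs_le]
  refine ⟨⟨?_, ?_⟩, ⟨?_, ?_⟩⟩ <;> linarith [q1.1, q1.2, q2.1, q2.2]

/-- **Low-frequency time-derivative estimate from the proof of Lemma 6.2:** at frequencies
`‖ξ‖ < δ` the second component of the damped wave propagator equals the time derivative
`−‖ξ‖² e^{−t‖ξ‖²}(v₀+v₁)` of the heat comparison, up to an error `O(t⁻²)`. -/
theorem dwProp_low_frequency_time_derivative (d : ℕ) (hd : 1 ≤ d) :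
    ∃ δ C : ℝ, δ ∈ Set.Ioc (0 : ℝ) (1 / 8) ∧ 0 < C ∧
      ∀ ξ : EuclideanSpace ℝ (Fin d), ‖ξ‖ < δ →
      ∀ t : ℝ, 1 ≤ t → ∀ v : Fin 2 → ℂ,
        ‖(dwProp d t ξ).mulVec v 1
            + ((‖ξ‖ ^ 2 : ℝ) : ℂ) * ((Real.exp (-(t * ‖ξ‖ ^ 2)) : ℂ) * (v 0 + v 1))‖
          ≤ C * t ^ (-(2 : ℝ)) * xiNorm d ξ v := by
  refine ⟨1 / 8, 200, by norm_num, by norm_num, ?_⟩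
  intro ξ hξ t ht v
  have hn := norm_nonneg ξ
  have hsq : ‖ξ‖ ^ 2 ≤ 1 / 64 := by nlinarith
  have hw : 0 ≤ 1 - 4 * ‖ξ‖ ^ 2 := by linarith
  obtain ⟨a, ha0, ha, hr⟩ : ∃ a : ℝ, 0 ≤ a ∧ a ≤ 1 / 4 ∧ ‖ξ‖ ^ 2 = a * (1 - a) := by
    refine ⟨(1 - Real.sqrt (1 - 4 * ‖ξ‖ ^ 2)) / 2, ?_, ?_, ?_⟩
    · have : Real.sqrt (1 - 4 * ‖ξ‖ ^ 2) ≤ 1 := Real.sqrt_le_one.2 (by nlinarith)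
      linarith
    · have : 1 / 2 ≤ Real.sqrt (1 - 4 * ‖ξ‖ ^ 2) := Real.le_sqrt_of_sq_le (by linarith)
      linarith
    · nlinarith [Real.sq_sqrt hw]
  obtain ⟨h0, h1⟩ := coeff_bounds a (‖ξ‖ ^ 2) t ha0 ha hr ht
  rw [dwProp_second d t ξ v a ha hr]
  set c0 := (-(a * (1 - a)) * Real.exp (-(a * t)) + a * (1 - a) * Real.exp (-((1 - a) * t)))
        / (1 - 2 * a)
  set c1 := (-a * Real.exp (-(a * t)) + (1 - a) * Real.exp (-((1 - a) * t))) / (1 - 2 * a)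
  set g := ‖ξ‖ ^ 2 * Real.exp (-(t * ‖ξ‖ ^ 2)) with hg
  have ht0 : 0 < t := by linarith
  have ht2 : 0 < t ^ 2 := by positivity
  have hpow : t ^ (-(2 : ℝ)) = 1 / t ^ 2 := by
    rw [Real.rpow_neg ht0.le, one_div]; norm_cast
  have hrew : (c0 : ℂ) * v 0 + (c1 : ℂ) * v 1
      + ((‖ξ‖ ^ 2 : ℝ) : ℂ) * ((Real.exp (-(t * ‖ξ‖ ^ 2)) : ℂ) * (v 0 + v 1))
      = ((c0 + g : ℝ) : ℂ) * v 0 + ((c1 + g : ℝ) : ℂ) * v 1 := by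
    rw [hg]; push_cast; ring
  have k0 : |c0 + g| ≤ 100 * (1 / t ^ 2) := by
    rw [mul_one_div, le_div_iff₀ ht2]; exact h0
  have k1 : |c1 + g| ≤ 100 * (1 / t ^ 2) := by
    rw [mul_one_div, le_div_iff₀ ht2]; exact h1
  have n0 : ‖v 0‖ ≤ xiNorm d ξ v := by
    apply Real.le_sqrt_of_sq_le
    nlinarith [sq_nonneg ‖v 1‖, mul_nonneg (sq_nonneg ‖ξ‖) (sq_nonneg ‖v 0‖)]
  have n1 : ‖v 1‖ ≤ xiNorm d ξ v := by
    apply Real.le_sqrt_of_sq_le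
    nlinarith [sq_nonneg ‖v 0‖, mul_nonneg (sq_nonneg ‖ξ‖) (sq_nonneg ‖v 0‖)]
  rw [hrew, hpow]
  calc _ ≤ ‖((c0 + g : ℝ) : ℂ) * v 0‖ + ‖((c1 + g : ℝ) : ℂ) * v 1‖ := norm_add_le _ _
    _ = |c0 + g| * ‖v 0‖ + |c1 + g| * ‖v 1‖ := by
      rw [norm_mul, norm_mul, Complex.norm_real, Complex.norm_real, Real.norm_eq_abs,
        Real.norm_eq_abs]
    _ ≤ 100 * (1 / t ^ 2) * xiNorm d ξ v + 100 * (1 / t ^ 2) * xiNorm d ξ v := by gcongr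
    _ = 200 * (1 / t ^ 2) * xiNorm d ξ v := by ring
end

section
/- Let n ≥ 1 be an integer and let μ > 0 be a real number. For j ∈ ℕ set ζ_j := (π j / 2)² and λ₀(j) := i·(π j / 2) + (μ/2)·(π j / 2)^{−n/(n+1)}·exp(i·π(n+2)/(2(n+1))) ∈ ℂ. Then there exist C > 0 and j₀ ∈ ℕ such that for every j ≥ j₀ there is exactly one λ ∈ ℂ with |λ − λ₀(j)| ≤ C j^{−(3n+1)/(n+1)} satisfying λ² + ζ_j + μ · λ^{1/(n+1)} = 0, where λ^{1/(n+1)} denotes the principal branch of the complex power (λ^{1/(n+1)} = exp((n+1)^{−1} Log λ) with Arg λ ∈ (−π, π)). -/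
open Real

/-- Banach fixed point theorem on a closed ball, existence and uniqueness. -/
lemma strip_fixed_point (T : ℂ → ℂ) (c : ℂ) (R K : ℝ) (hR : 0 ≤ R) (hK0 : 0 ≤ K) (hK : K < 1)
    (hmap : ∀ x, ‖x - c‖ ≤ R → ‖T x - c‖ ≤ R)
    (hlip : ∀ x y, ‖x - c‖ ≤ R → ‖y - c‖ ≤ R → ‖T x - T y‖ ≤ K * ‖x - y‖) :
    ∃! x, ‖x - c‖ ≤ R ∧ T x = x := by
  have hs : IsComplete (Metric.closedBall c R) := Metric.isClosed_closedBall.isComplete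
  have hm : Set.MapsTo T (Metric.closedBall c R) (Metric.closedBall c R) := by
    intro x hx
    rw [mem_closedBall_iff_norm] at hx ⊢
    exact hmap x hx
  have hc : ContractingWith (⟨K, hK0⟩ : NNReal) (hm.restrict T _ _) := by
    refine ⟨by exact_mod_cast hK, LipschitzWith.of_dist_le_mul ?_⟩
    rintro ⟨x, hx⟩ ⟨y, hy⟩
    rw [mem_closedBall_iff_norm] at hx hy
    simp only [Subtype.dist_eq, Set.MapsTo.val_restrict_apply, dist_eq_norm]
    exact hlip x y hx hy
  obtain ⟨y, hy, hfy, -⟩ := ContractingWith.exists_fixedPoint' hs hm hc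
    (Metric.mem_closedBall_self hR) (edist_ne_top _ _)
  rw [mem_closedBall_iff_norm] at hy
  refine ⟨y, ⟨hy, hfy⟩, ?_⟩
  rintro z ⟨hz, hfz⟩
  have h := hlip z y hz hy
  rw [hfz, hfy.eq] at h
  have h0 : ‖z - y‖ = 0 := by nlinarith [norm_nonneg (z - y)]
  exact sub_eq_zero.mp (norm_eq_zero.mp h0)

/-- Lipschitz bound for the principal power near `i s`. -/
lemma strip_cpow_lip (s a : ℝ) (hs : 0 < s) (ha0 : 0 < a) (ha1 : a ≤ 1) (x y : ℂ)
    (hx : ‖x - Complex.I * s‖ ≤ s / 2) (hy : ‖y - Complex.I * s‖ ≤ s / 2) :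
    ‖x ^ (a : ℂ) - y ^ (a : ℂ)‖ ≤ 2 * s ^ (a - 1) * ‖x - y‖ := by
  have him : ∀ z ∈ Metric.closedBall (Complex.I * (s : ℂ)) (s / 2), s / 2 ≤ z.im := by
    intro z hz
    rw [mem_closedBall_iff_norm] at hz
    have := (abs_le.mp ((Complex.abs_im_le_norm _).trans hz)).1
    simp at this
    linarith
  refine Convex.norm_image_sub_le_of_norm_hasDerivWithin_le
    (f := fun z : ℂ => z ^ (a : ℂ)) (f' := fun z : ℂ => (a : ℂ) * z ^ ((a : ℂ) - 1) * 1)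
    (s := Metric.closedBall (Complex.I * (s : ℂ)) (s / 2)) ?_ ?_
    (convex_closedBall _ _) (mem_closedBall_iff_norm.mpr hy) (mem_closedBall_iff_norm.mpr hx)
  · intro z hz
    have h := him z hz
    exact ((hasDerivAt_id z).cpow_const (Or.inr (by simp; linarith))).hasDerivWithinAt
  · intro z hz
    have h := him z hz
    have hzn : s / 2 ≤ ‖z‖ := h.trans ((le_abs_self _).trans (Complex.abs_im_le_norm z))
    have hz0 : z ≠ 0 := by
      rintro rfl
      simp at h
      linarith
    have e : ((a : ℂ) - 1) = ((a - 1 : ℝ) : ℂ) := by push_cast; rfl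
    rw [mul_one, norm_mul, e, Complex.norm_cpow_real, Complex.norm_real, Real.norm_eq_abs,
      abs_of_pos ha0]
    have h1 : ‖z‖ ^ (a - 1) ≤ (s / 2) ^ (a - 1) :=
      Real.rpow_le_rpow_of_nonpos (by linarith) hzn (by linarith)
    have h2 : (s / 2) ^ (a - 1) ≤ 2 * s ^ (a - 1) := by
      rw [Real.div_rpow hs.le (by norm_num), div_eq_mul_inv, mul_comm, ← Real.rpow_neg (by norm_num)]
      have : (2 : ℝ) ^ (-(a - 1)) ≤ 2 ^ (1 : ℝ) :=
        Real.rpow_le_rpow_of_exponent_le (by norm_num) (by linarith)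
      rw [Real.rpow_one] at this
      exact mul_le_mul_of_nonneg_right this (by positivity)
    have h3 : 0 ≤ ‖z‖ ^ (a - 1) := by positivity
    nlinarith

/-- The approximate eigenvalue is the first Picard iterate. -/
lemma strip_center (s a μ : ℝ) (hs : 0 < s) :
    Complex.I * (s : ℂ) + ((μ / 2 : ℝ) : ℂ) * ((s ^ (a - 1) : ℝ) : ℂ)
      * Complex.exp (Complex.I * ((π * (1 + a) / 2 : ℝ) : ℂ))
    = Complex.I * s - (μ * (Complex.I * s) ^ (a : ℂ)) / (2 * (Complex.I * s)) := by
  have hsc : (s : ℂ) ≠ 0 := by exact_mod_cast hs.ne'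
  have hne : Complex.I * (s : ℂ) ≠ 0 := mul_ne_zero Complex.I_ne_zero hsc
  have hlog : Complex.log (Complex.I * s) = (Real.log s : ℂ) + π / 2 * Complex.I := by
    rw [mul_comm, Complex.log_ofReal_mul hs Complex.I_ne_zero, Complex.log_I]
  have h1 : (Complex.I * (s : ℂ)) ^ (a : ℂ) / (Complex.I * s)
      = (Complex.I * (s : ℂ)) ^ ((a : ℂ) - 1) := by
    rw [Complex.cpow_sub _ _ hne, Complex.cpow_one]
  have h2 : (Complex.I * (s : ℂ)) ^ ((a : ℂ) - 1)
      = - (((s ^ (a - 1) : ℝ) : ℂ)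
      * Complex.exp (Complex.I * ((π * (1 + a) / 2 : ℝ) : ℂ))) := by
    rw [Complex.cpow_def_of_ne_zero hne, hlog, Real.rpow_def_of_pos hs, Complex.ofReal_exp,
      ← Complex.exp_add, ← Complex.exp_sub_pi_mul_I]
    congr 1
    push_cast
    ring
  have h3 : (μ * (Complex.I * (s : ℂ)) ^ (a : ℂ)) / (2 * (Complex.I * s))
      = μ / 2 * ((Complex.I * (s : ℂ)) ^ (a : ℂ) / (Complex.I * s)) := by
    field_simp
  rw [h3, h1, h2]
  push_cast
  ring

lemma strip_main (s a μ R C : ℝ) (hs : 0 < s) (ha0 : 0 < a) (ha1 : a ≤ 1) (hμ : 0 < μ)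
    (hC : C = (1 + 2 * μ) * (1 + μ)) (hs1 : 1 ≤ s) (hs2 : 2 * (1 + 2 * μ) ≤ s)
    (hR1 : C * s ^ (2 * a - 3) ≤ R) (hR2 : R ≤ s ^ (a - 1)) (c : ℂ)
    (hc : c = Complex.I * s - (μ * (Complex.I * s) ^ (a : ℂ)) / (2 * (Complex.I * s))) :
    ∃! l : ℂ, ‖l - c‖ ≤ R ∧ l ^ 2 + ((s ^ 2 : ℝ) : ℂ) + (μ : ℂ) * l ^ (a : ℂ) = 0 := by
  have hsc : (s : ℂ) ≠ 0 := by exact_mod_cast hs.ne'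
  have hne : Complex.I * (s : ℂ) ≠ 0 := mul_ne_zero Complex.I_ne_zero hsc
  set p : ℂ := Complex.I * s with hp
  have hpp : p ^ 2 = - (s : ℂ) ^ 2 := by rw [hp, mul_pow, Complex.I_sq]; ring
  have hpn : ‖p‖ = s := by simp [hp, abs_of_pos hs]
  set q : ℝ := s ^ (a - 1) with hq
  have hq0 : 0 < q := by positivity
  have hq1 : q ≤ 1 := Real.rpow_le_one_of_one_le_of_nonpos hs1 (by linarith)
  have hqq : s ^ (2 * a - 3) = q * q / s := by
    rw [hq, ← Real.rpow_add hs, ← Real.rpow_sub_one hs.ne']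
    congr 1
    ring
  have hC0 : 0 < C := by rw [hC]; positivity
  have hR0 : 0 ≤ R := le_trans (by positivity) hR1
  set T : ℂ → ℂ := fun l => p - ((l - p) ^ 2 + μ * l ^ (a : ℂ)) / (2 * p) with hT
  have hTp : T p = c := by rw [hc]; simp [hT]
  have hcp : ‖c - p‖ = μ / 2 * q := by
    have : c - p = - ((μ * p ^ (a : ℂ)) / (2 * p)) := by rw [hc]; ring
    rw [this, norm_neg, norm_div, norm_mul, norm_mul, Complex.norm_cpow_real, hpn,
      Complex.norm_real, Real.norm_eq_abs, abs_of_pos hμ, hq, Real.rpow_sub_one hs.ne']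
    simp
    field_simp
  have hball : ∀ x, ‖x - c‖ ≤ R → ‖x - p‖ ≤ (1 + μ) * q := by
    intro x hx
    have : ‖x - p‖ ≤ ‖x - c‖ + ‖c - p‖ := norm_sub_le_norm_sub_add_norm_sub _ _ _
    nlinarith
  have hsmall : (1 + μ) * q ≤ s / 2 := by nlinarith
  have hlip : ∀ x y, ‖x - p‖ ≤ (1 + μ) * q → ‖y - p‖ ≤ (1 + μ) * q →
      ‖T x - T y‖ ≤ ((1 + 2 * μ) * q / s) * ‖x - y‖ := by
    intro x y hx hy
    have h1 := strip_cpow_lip s a hs ha0 ha1 x y (hx.trans hsmall) (hy.trans hsmall)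
    rw [← hq] at h1
    have h2 : T x - T y = - (((x - p) + (y - p)) * (x - y)
        + μ * (x ^ (a : ℂ) - y ^ (a : ℂ))) / (2 * p) := by
      simp only [hT]; ring
    rw [h2, norm_div, norm_neg, norm_mul, hpn, div_le_iff₀ (by simp; exact hs)]
    have h3 : ‖((x - p) + (y - p)) * (x - y) + μ * (x ^ (a : ℂ) - y ^ (a : ℂ))‖
        ≤ (2 * ((1 + μ) * q)) * ‖x - y‖ + μ * (2 * q * ‖x - y‖) := by
      refine (norm_add_le _ _).trans (add_le_add ?_ ?_)
      · rw [norm_mul]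
        refine mul_le_mul_of_nonneg_right ?_ (norm_nonneg _)
        have := norm_add_le (x - p) (y - p)
        linarith
      · rw [norm_mul, Complex.norm_real, Real.norm_eq_abs, abs_of_pos hμ]
        exact mul_le_mul_of_nonneg_left h1 hμ.le
    refine h3.trans (le_of_eq ?_)
    simp
    field_simp
    ring
  have key := strip_fixed_point T c R ((1 + 2 * μ) * q / s) hR0 (by positivity)
    (by rw [div_lt_one hs]; nlinarith) ?_ (fun x y hx hy => hlip x y (hball x hx) (hball y hy))
  · have hiff : ∀ l : ℂ, l ^ 2 + ((s ^ 2 : ℝ) : ℂ) + (μ : ℂ) * l ^ (a : ℂ) = 0 ↔ T l = l := by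
      intro l
      have e : l ^ 2 + ((s ^ 2 : ℝ) : ℂ) + (μ : ℂ) * l ^ (a : ℂ) = (2 * p) * (l - T l) := by
        have : (2 * p) * (l - T l) = 2 * p * (l - p) + ((l - p) ^ 2 + μ * l ^ (a : ℂ)) := by
          simp only [hT]
          field_simp
          ring
        rw [this]
        push_cast
        linear_combination (-1) * hpp * (-1)
      rw [e, mul_eq_zero, sub_eq_zero]
      constructor
      · rintro (h | h)
        · exact absurd h (mul_ne_zero two_ne_zero hne)
        · exact h.symm
      · intro h
        exact Or.inr h.symm
    simpa only [hiff] using key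
  · intro x hx
    have h := hlip x p (hball x hx) (by simp; positivity)
    rw [hTp] at h
    refine h.trans (le_trans ?_ hR1)
    rw [hqq, hC]
    calc (1 + 2 * μ) * q / s * ‖x - p‖ ≤ (1 + 2 * μ) * q / s * ((1 + μ) * q) :=
          mul_le_mul_of_nonneg_left (hball x hx) (by positivity)
      _ = _ := by ring

/-- **Eigenvalue asymptotics on the strip (core of Proposition 7.2):** for each fixed `μ > 0`
and all large `j`, the function `F(λ) = λ² + (πj/2)² + μ λ^{1/(n+1)}` (principal branch)
has exactly one zero at distance `O(j^{−(3n+1)/(n+1)})` from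
`λ₀(j) = i πj/2 + (μ/2)(πj/2)^{−n/(n+1)} e^{iπ(n+2)/(2(n+1))}`. -/
theorem eigenvalue_asymptotics_strip
    (n : ℕ) (hn : 1 ≤ n) (μ : ℝ) (hμ : 0 < μ) :
    ∃ C : ℝ, 0 < C ∧ ∃ j₀ : ℕ, ∀ j : ℕ, j₀ ≤ j →
      ∃! l : ℂ,
        norm (l - (Complex.I * ((π * j / 2 : ℝ) : ℂ)
            + ((μ / 2 : ℝ) : ℂ)
              * (((π * j / 2 : ℝ) ^ (-(n : ℝ) / ((n : ℝ) + 1)) : ℝ) : ℂ)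
              * Complex.exp (Complex.I * ((π * ((n : ℝ) + 2) / (2 * ((n : ℝ) + 1)) : ℝ) : ℂ))))
          ≤ C * (j : ℝ) ^ (-((3 * (n : ℝ) + 1) / ((n : ℝ) + 1))) ∧
        l ^ 2 + (((π * j / 2 : ℝ) ^ 2 : ℝ) : ℂ) + (μ : ℂ) * l ^ (((n : ℂ) + 1)⁻¹) = 0 := by
  have hn1 : (0 : ℝ) < (n : ℝ) + 1 := by positivity
  obtain ⟨a, ha⟩ : ∃ a : ℝ, a = ((n : ℝ) + 1)⁻¹ := ⟨_, rfl⟩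
  have ha0 : 0 < a := by rw [ha]; positivity
  have ha1 : a ≤ 1 := by
    rw [ha]
    exact inv_le_one_of_one_le₀ (by linarith [(Nat.cast_nonneg n : (0 : ℝ) ≤ n)])
  have e1 : -(n : ℝ) / ((n : ℝ) + 1) = a - 1 := by rw [ha]; field_simp; ring
  have e2 : π * ((n : ℝ) + 2) / (2 * ((n : ℝ) + 1)) = π * (1 + a) / 2 := by
    rw [ha]; field_simp; ring
  have e3 : -((3 * (n : ℝ) + 1) / ((n : ℝ) + 1)) = 2 * a - 3 := by rw [ha]; field_simp; ring
  have e4 : ((n : ℂ) + 1)⁻¹ = (a : ℂ) := by rw [ha]; push_cast; rfl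
  rw [e1, e2, e3, e4]
  obtain ⟨C, hC⟩ : ∃ C : ℝ, C = (1 + 2 * μ) * (1 + μ) := ⟨_, rfl⟩
  have hC0 : 0 < C := by rw [hC]; positivity
  refine ⟨C, hC0, ⌈1 + 2 * C + 2 * (1 + 2 * μ)⌉₊, fun j hj => ?_⟩
  have hj' : 1 + 2 * C + 2 * (1 + 2 * μ) ≤ (j : ℝ) := Nat.ceil_le.mp hj
  have hj1 : (1 : ℝ) ≤ j := by linarith
  have hj0 : (0 : ℝ) < j := by linarith
  obtain ⟨s, hs⟩ : ∃ s : ℝ, s = π * j / 2 := ⟨_, rfl⟩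
  have hsj : (j : ℝ) ≤ s := by rw [hs]; nlinarith [Real.pi_gt_three]
  have hsj2 : s ≤ 2 * j := by rw [hs]; nlinarith [Real.pi_lt_four]
  have hs0 : 0 < s := by linarith
  rw [← hs]
  refine strip_main s a μ _ C hs0 ha0 ha1 hμ hC (by linarith) (by linarith) ?_ ?_ _
    (strip_center s a μ hs0)
  · exact mul_le_mul_of_nonneg_left
      (Real.rpow_le_rpow_of_nonpos hj0 hsj (by linarith)) hC0.le
  · have h1 : (2 * (j : ℝ)) ^ (a - 1) ≤ s ^ (a - 1) :=
      Real.rpow_le_rpow_of_nonpos hs0 hsj2 (by linarith)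
    have h2 : (2 : ℝ)⁻¹ ≤ 2 ^ (a - 1) := by
      rw [← Real.rpow_neg_one]
      exact Real.rpow_le_rpow_of_exponent_le (by norm_num) (by linarith)
    rw [Real.mul_rpow (by norm_num) hj0.le] at h1
    have h3 : (j : ℝ) ^ (2 * a - 3) = (j : ℝ) ^ (a - 1) * (j : ℝ) ^ (a - 1) / j := by
      rw [← Real.rpow_add hj0, ← Real.rpow_sub_one hj0.ne']
      congr 1
      ring
    have h4 : (j : ℝ) ^ (a - 1) ≤ 1 := Real.rpow_le_one_of_one_le_of_nonpos hj1 (by linarith)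
    have h5 : 0 < (j : ℝ) ^ (a - 1) := by positivity
    refine le_trans ?_ h1
    rw [h3]
    generalize (j : ℝ) ^ (a - 1) = q at *
    have h6 : C * (q * q / j) = (C / j) * q * q := by ring
    have h7 : C / j ≤ 2⁻¹ := by
      rw [div_le_iff₀ hj0]
      linarith
    have h8 : 0 ≤ C / j := by positivity
    rw [h6]
    refine mul_le_mul_of_nonneg_right ?_ h5.le
    nlinarith
end
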